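/- The subspace $V_D := D + (D^\perp \cap V_+)$ satisfies $D \subseteq V_D \subseteq D^\perp$, and $\langle w, w\rangle > 0$ for every $w \in V_D$ with $w \notin D$; in other words, $V_D$ is a pre-$D$-transverse generalized metric. -/

import Mathlib

/-- The canonical symmetric pairing on `E = T × T*` (with `T* = T →ₗ[ℝ] ℝ` the
dual space): `⟨(u,α),(v,β)⟩ = (α v + β u) / 2`. -/
noncomputable def pairing (T : Type*) [AddCommGroup T] [Module ℝ T] :
    LinearMap.BilinForm ℝ (T × (T →ₗ[ℝ] ℝ)) :=
  LinearMap.mk₂ ℝ (fun e f => (e.2 f.1 + f.2 e.1) / 2)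
    (fun a b c => by simp; ring)
    (fun r a b => by simp [smul_eq_mul]; ring)
    (fun a b c => by simp; ring)
    (fun r a b => by simp [smul_eq_mul]; ring)

/-- `perp S = {e ∈ E | ⟨e, s⟩ = 0 for all s ∈ S}`. -/
noncomputable def perp {T : Type*} [AddCommGroup T] [Module ℝ T]
    (S : Submodule ℝ (T × (T →ₗ[ℝ] ℝ))) :
    Submodule ℝ (T × (T →ₗ[ℝ] ℝ)) where
  carrier := {e | ∀ s ∈ S, pairing T e s = 0}
  zero_mem' := fun s hs => by simp
  add_mem' := fun {a b} ha hb s hs => by simp [ha s hs, hb s hs]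
  smul_mem' := fun r a ha s hs => by simp [ha s hs]

/-- `V₊ = {(u, g(u,·)) : u ∈ T}`, the graph of `g`. -/
noncomputable def Vplus {T : Type*} [AddCommGroup T] [Module ℝ T]
    (g : LinearMap.BilinForm ℝ T) : Submodule ℝ (T × (T →ₗ[ℝ] ℝ)) :=
  LinearMap.range ((LinearMap.id : T →ₗ[ℝ] T).prod g)

/-- `V₋ = {(u, -g(u,·)) : u ∈ T}`, the graph of `-g`. -/
noncomputable def Vminus {T : Type*} [AddCommGroup T] [Module ℝ T]
    (g : LinearMap.BilinForm ℝ T) : Submodule ℝ (T × (T →ₗ[ℝ] ℝ)) :=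
  LinearMap.range ((LinearMap.id : T →ₗ[ℝ] T).prod (-g))

theorem pairing_apply {T : Type*} [AddCommGroup T] [Module ℝ T]
    (e f : T × (T →ₗ[ℝ] ℝ)) : pairing T e f = (e.2 f.1 + f.2 e.1) / 2 :=
  rfl

theorem pairing_comm {T : Type*} [AddCommGroup T] [Module ℝ T]
    (e f : T × (T →ₗ[ℝ] ℝ)) : pairing T e f = pairing T f e := by
  rw [pairing_apply, pairing_apply, add_comm]

theorem pairing_self_pos_of_mem_Vplus {T : Type*} [AddCommGroup T] [Module ℝ T]
    {g : LinearMap.BilinForm ℝ T} (hg_pos : ∀ u : T, u ≠ 0 → 0 < g u u)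
    {e : T × (T →ₗ[ℝ] ℝ)} (he : e ∈ Vplus g) (hne : e ≠ 0) : 0 < pairing T e e := by
  obtain ⟨u, rfl⟩ := he
  have hu : u ≠ 0 := by
    rintro rfl
    exact hne (map_zero _)
  simpa [pairing_apply] using hg_pos u hu

/-- The map `(x, ξ) ↦ ξ + g x`, whose kernel is `V₋`. -/
noncomputable def addLower {T : Type*} [AddCommGroup T] [Module ℝ T]
    (g : LinearMap.BilinForm ℝ T) : (T × (T →ₗ[ℝ] ℝ)) →ₗ[ℝ] Module.Dual ℝ T :=
  LinearMap.snd ℝ T (T →ₗ[ℝ] ℝ) + LinearMap.comp g (LinearMap.fst ℝ T (T →ₗ[ℝ] ℝ))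

theorem addLower_apply {T : Type*} [AddCommGroup T] [Module ℝ T]
    (g : LinearMap.BilinForm ℝ T) (e : T × (T →ₗ[ℝ] ℝ)) (u : T) :
    addLower g e u = e.2 u + g e.1 u :=
  rfl

theorem eq_zero_of_addLower_eq_zero {T : Type*} [AddCommGroup T] [Module ℝ T]
    {g : LinearMap.BilinForm ℝ T} (hg_pos : ∀ u : T, u ≠ 0 → 0 < g u u)
    {e : T × (T →ₗ[ℝ] ℝ)} (he : pairing T e e = 0) (h : addLower g e = 0) : e = 0 := by
  have happ (u : T) : e.2 u + g e.1 u = 0 := by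
    rw [← addLower_apply, h, LinearMap.zero_apply]
  have hfst : e.1 = 0 := by
    by_contra hne
    have hpos := hg_pos e.1 hne
    have hself := happ e.1
    rw [pairing_apply] at he
    linarith
  refine Prod.ext hfst (LinearMap.ext fun u => ?_)
  simpa [hfst] using happ u

theorem finrank_map_addLower {T : Type*} [AddCommGroup T] [Module ℝ T]
    {g : LinearMap.BilinForm ℝ T} (hg_pos : ∀ u : T, u ≠ 0 → 0 < g u u)
    {D : Submodule ℝ (T × (T →ₗ[ℝ] ℝ))} (hD : D ≤ perp D) :
    Module.finrank ℝ (D.map (addLower g)) = Module.finrank ℝ D := by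
  have hinj : Function.Injective ((addLower g).domRestrict D) := by
    refine (injective_iff_map_eq_zero _).2 fun e he => Subtype.ext ?_
    exact eq_zero_of_addLower_eq_zero hg_pos (hD e.2 e e.2) he
  rw [← LinearMap.range_domRestrict, LinearMap.finrank_range_of_inj hinj]

theorem perp_inf_Vplus_eq_map {T : Type*} [AddCommGroup T] [Module ℝ T]
    {g : LinearMap.BilinForm ℝ T} (hg_symm : ∀ u v : T, g u v = g v u)
    (D : Submodule ℝ (T × (T →ₗ[ℝ] ℝ))) :
    perp D ⊓ Vplus g = (D.map (addLower g)).dualCoannihilator.map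
      ((LinearMap.id : T →ₗ[ℝ] T).prod g) := by
  have hpair (u : T) (e : T × (T →ₗ[ℝ] ℝ)) :
      pairing T (u, g u) e = addLower g e u / 2 := by
    rw [pairing_apply, addLower_apply, hg_symm u e.1, add_comm]
  ext e
  constructor
  · rintro ⟨he, u, rfl⟩
    refine ⟨u, (Submodule.mem_dualCoannihilator _).2 ?_, rfl⟩
    rintro _ ⟨d, hd, rfl⟩
    have h := he d hd
    change pairing T (u, g u) d = 0 at h
    rw [hpair] at h
    linarith
  · rintro ⟨u, hu, rfl⟩
    refine ⟨fun d hd => ?_, u, rfl⟩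
    change pairing T (u, g u) d = 0
    rw [hpair, (Submodule.mem_dualCoannihilator _).1 hu _ ⟨d, hd, rfl⟩, zero_div]

theorem finrank_perp_inf_Vplus {T : Type*} [AddCommGroup T] [Module ℝ T]
    [FiniteDimensional ℝ T] {g : LinearMap.BilinForm ℝ T}
    (hg_symm : ∀ u v : T, g u v = g v u) (hg_pos : ∀ u : T, u ≠ 0 → 0 < g u u)
    {D : Submodule ℝ (T × (T →ₗ[ℝ] ℝ))} (hD : D ≤ perp D) :
    Module.finrank ℝ D + Module.finrank ℝ (perp D ⊓ Vplus g : Submodule ℝ _) =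
      Module.finrank ℝ T := by
  have hinj : Function.Injective ((LinearMap.id : T →ₗ[ℝ] T).prod g) :=
    fun _ _ h => congrArg Prod.fst h
  rw [perp_inf_Vplus_eq_map hg_symm, ← (Submodule.equivMapOfInjective _ hinj _).finrank_eq,
    ← finrank_map_addLower hg_pos hD]
  exact Subspace.finrank_add_finrank_dualCoannihilator_eq _

theorem disjoint_perp_inf_Vplus {T : Type*} [AddCommGroup T] [Module ℝ T]
    {g : LinearMap.BilinForm ℝ T} (hg_pos : ∀ u : T, u ≠ 0 → 0 < g u u)
    (D : Submodule ℝ (T × (T →ₗ[ℝ] ℝ))) : Disjoint D (perp D ⊓ Vplus g) := by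
  rw [Submodule.disjoint_def]
  rintro e heD ⟨hperp, hplus⟩
  by_contra hne
  exact (pairing_self_pos_of_mem_Vplus hg_pos hplus hne).ne' (hperp e heD)

/-- `V_D = D + (Dᗮ ∩ V₊)` satisfies `D ⊆ V_D ⊆ Dᗮ` and
`⟨w,w⟩ > 0` for `w ∈ V_D \ D`; i.e. (together with `dim V_D = n`) it is a
pre-`D`-transverse generalized metric. -/
theorem stmt6 {T : Type*} [AddCommGroup T] [Module ℝ T] [FiniteDimensional ℝ T]
    (g : LinearMap.BilinForm ℝ T)
    (hg_symm : ∀ u v : T, g u v = g v u)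
    (hg_pos : ∀ u : T, u ≠ 0 → 0 < g u u)
    (D : Submodule ℝ (T × (T →ₗ[ℝ] ℝ)))
    (hD_iso : D ≤ perp D) :
    D ≤ D ⊔ (perp D ⊓ Vplus g) ∧
    D ⊔ (perp D ⊓ Vplus g) ≤ perp D ∧
    (∀ w ∈ D ⊔ (perp D ⊓ Vplus g), w ∉ D → 0 < pairing T w w) ∧
    Module.finrank ℝ (D ⊔ (perp D ⊓ Vplus g) : Submodule ℝ (T × (T →ₗ[ℝ] ℝ))) =
      Module.finrank ℝ T := by
  refine ⟨le_sup_left, sup_le hD_iso inf_le_left, ?_, ?_⟩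
  · intro w hw hwD
    obtain ⟨d, hd, v, ⟨hvperp, hvplus⟩, rfl⟩ := Submodule.mem_sup.1 hw
    have hv : v ≠ 0 := by
      rintro rfl
      exact hwD (by simpa using hd)
    have hself : pairing T (d + v) (d + v) = pairing T v v := by
      simp only [map_add, LinearMap.add_apply]
      rw [pairing_comm d v, hD_iso hd d hd, hvperp d hd]
      ring
    rw [hself]
    exact pairing_self_pos_of_mem_Vplus hg_pos hvplus hv
  · have hsum := Submodule.finrank_sup_add_finrank_inf_eq D (perp D ⊓ Vplus g)
    rw [(disjoint_perp_inf_Vplus hg_pos D).eq_bot, finrank_bot, add_zero] at hsum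
    rw [hsum, finrank_perp_inf_Vplus hg_symm hg_pos hD_iso]
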